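/- arXiv:2311.13523 — 2 statements merged into one kernel-verified Lean document; each statement's English description precedes it below -/
import Mathlib

section
/- Every triangle-free subcubic graph admits a forest storyplan: there is a vertex order such that at every step the visible induced subgraph is acyclic and has at most five edges. -/
/-- `H` is a minor of `G`: disjoint connected branch sets, one per vertex of `H`,
with an edge of `G` between branch sets of adjacent vertices of `H`. -/
def SimpleGraph.IsMinorOf {W V : Type*} (H : SimpleGraph W) (G : SimpleGraph V) : Prop :=
  ∃ f : W → Set V,
    (∀ w, (G.induce (f w)).Connected) ∧
    (∀ w₁ w₂, w₁ ≠ w₂ → Disjoint (f w₁) (f w₂)) ∧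
    (∀ w₁ w₂, H.Adj w₁ w₂ → ∃ a ∈ f w₁, ∃ b ∈ f w₂, G.Adj a b)

/-- Planarity via Wagner's theorem: no `K₅` minor and no `K₃,₃` minor. -/
def SimpleGraph.IsPlanar {V : Type*} (G : SimpleGraph V) : Prop :=
  ¬ (completeGraph (Fin 5)).IsMinorOf G ∧
  ¬ (completeBipartiteGraph (Fin 3) (Fin 3)).IsMinorOf G

/-- Outerplanarity: no `K₄` minor and no `K₂,₃` minor. -/
def SimpleGraph.IsOuterplanar {V : Type*} (G : SimpleGraph V) : Prop :=
  ¬ (completeGraph (Fin 4)).IsMinorOf G ∧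
  ¬ (completeBipartiteGraph (Fin 2) (Fin 3)).IsMinorOf G

/-- Vertex `v` is visible at step `i`: `τ v ≤ i ≤ max_{u ∈ N[v]} τ u`. -/
def visibleAt {V : Type*} {n : ℕ} (G : SimpleGraph V) (τ : V ≃ Fin n) (v : V) (i : Fin n) :
    Prop :=
  τ v ≤ i ∧ ∃ u, (u = v ∨ G.Adj v u) ∧ i ≤ τ u

/-- The `i`-th frame: the subgraph induced by the vertices visible at step `i`. -/
def frame {V : Type*} {n : ℕ} (G : SimpleGraph V) (τ : V ≃ Fin n) (i : Fin n) :
    SimpleGraph {v : V // visibleAt G τ v i} :=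
  G.induce {v | visibleAt G τ v i}

def IsForestStoryplan {V : Type*} {n : ℕ} (G : SimpleGraph V) (τ : V ≃ Fin n) : Prop :=
  ∀ i : Fin n, (frame G τ i).IsAcyclic

def IsOuterplanarStoryplan {V : Type*} {n : ℕ} (G : SimpleGraph V) (τ : V ≃ Fin n) : Prop :=
  ∀ i : Fin n, (frame G τ i).IsOuterplanar

def IsPlanarStoryplan {V : Type*} {n : ℕ} (G : SimpleGraph V) (τ : V ≃ Fin n) : Prop :=
  ∀ i : Fin n, (frame G τ i).IsPlanar

namespace SimpleGraph

variable {V : Type*} {G : SimpleGraph V}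

/-- Every edge of `G` inside `S` has `a` or `b` as an endpoint. -/
def CoveredByPair (G : SimpleGraph V) (S : Set V) (a b : V) : Prop :=
  ∀ u ∈ S, ∀ v ∈ S, G.Adj u v → u = a ∨ u = b ∨ v = a ∨ v = b

theorem CliqueFree.not_adj_of_adj_of_adj (htf : G.CliqueFree 3) {a b c : V}
    (hab : G.Adj a b) (hac : G.Adj a c) : ¬ G.Adj b c := by
  classical
  intro hbc
  exact htf {a, b, c} (is3Clique_triple_iff.2 ⟨hab, hac, hbc⟩)

/-- In a triangle-free graph, a set whose edges are covered by the two ends of an edge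
(or by a single vertex) induces a forest. -/
theorem CoveredByPair.isAcyclic_induce (htf : G.CliqueFree 3) {S : Set V} {a b : V}
    (hab : a = b ∨ G.Adj a b) (hS : G.CoveredByPair S a b) : (G.induce S).IsAcyclic := by
  classical
  intro s c hc
  have hsupp : ∀ z ∈ c.support, (z : V) = a ∨ (z : V) = b := by
    intro z hz
    by_contra hne
    push Not at hne
    obtain ⟨p, q, hpq, hset⟩ :=
      Set.ncard_eq_two.1 (hc.ncard_neighborSet_toSubgraph_eq_two hz)
    have hnbr : ∀ r ∈ c.toSubgraph.neighborSet z,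
        G.Adj z r ∧ ((r : V) = a ∨ (r : V) = b) := by
      intro r hr
      have hadj : G.Adj z r := (show c.toSubgraph.Adj z r from hr).adj_sub
      have := hS z z.2 r r.2 hadj
      tauto
    obtain ⟨hzp, hp⟩ := hnbr p (by simp [hset])
    obtain ⟨hzq, hq⟩ := hnbr q (by simp [hset])
    have hpq' : (p : V) ≠ q := fun h => hpq (Subtype.ext h)
    have hnot := htf.not_adj_of_adj_of_adj hzp hzq
    rcases hab with hab | hab
    · grind
    · have := hab.symm
      rcases hp with hp | hp <;> rcases hq with hq | hq <;> rw [hp, hq] at hpq' hnot <;> tauto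
  have hcard : (c.support.tail.map Subtype.val).toFinset.card ≤ ({a, b} : Finset V).card := by
    apply Finset.card_le_card
    intro z hz
    simp only [List.mem_toFinset, List.mem_map] at hz
    obtain ⟨y, hy, rfl⟩ := hz
    simpa using hsupp y (List.mem_of_mem_tail hy)
  rw [List.toFinset_card_of_nodup (hc.support_nodup.map Subtype.val_injective)] at hcard
  have := hc.three_le_length
  have := Finset.card_le_two (a := a) (b := b)
  simp at hcard
  omega

/-- A set whose edges are covered by the two ends of an edge (or by a single vertex) of a
subcubic graph induces at most five edges. -/
theorem CoveredByPair.ncard_edgeSet_induce_le [Fintype V] [DecidableEq V] [DecidableRel G.Adj]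
    (hdeg : ∀ v : V, G.degree v ≤ 3) {S : Set V} {a b : V}
    (hab : a = b ∨ G.Adj a b) (hS : G.CoveredByPair S a b) :
    (G.induce S).edgeSet.ncard ≤ 5 := by
  have hsub : Sym2.map Subtype.val '' (G.induce S).edgeSet ⊆
      ((G.incidenceFinset a ∪ G.incidenceFinset b : Finset (Sym2 V)) : Set (Sym2 V)) := by
    rintro _ ⟨e, he, rfl⟩
    induction e with
    | h u v =>
      have hadj : G.Adj u v := by simpa using he
      have hcov := hS u u.2 v v.2 hadj
      simp only [Finset.coe_union, Set.mem_union, Finset.mem_coe, mem_incidenceFinset,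
        incidenceSet, Sym2.map_mk, Set.mem_ofPred_eq, mem_edgeSet, hadj, true_and, Sym2.mem_iff]
      grind
  rw [← Set.ncard_image_of_injective _ (Sym2.map.injective Subtype.val_injective)]
  refine (Set.ncard_le_ncard hsub).trans ?_
  rw [Set.ncard_coe_finset]
  have ha := hdeg a
  have hb := hdeg b
  rw [← card_incidenceFinset_eq_degree] at ha hb
  rcases hab with rfl | hab
  · rw [Finset.union_self]
    omega
  · have hpos : 0 < (G.incidenceFinset a ∩ G.incidenceFinset b).card :=
      Finset.card_pos.2 ⟨s(a, b), by simp [incidenceSet, hab]⟩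
    have := Finset.card_union_add_card_inter (G.incidenceFinset a) (G.incidenceFinset b)
    omega

/-- The vertices of `P` that still have a neighbour outside `P`. -/
def activeSet (G : SimpleGraph V) (P : Finset V) : Set V :=
  {v | v ∈ P ∧ ∃ u, u ∉ P ∧ G.Adj v u}

/-- The invariant kept by the greedy construction of a storyplan: either the active vertices are
independent, or all their edges meet a vertex `x` that has a single neighbour outside `P`, or
all their edges meet an active vertex `x` that is the only neighbour in `P` of each of its
neighbours outside `P`. -/
def Extendable (G : SimpleGraph V) (P : Finset V) : Prop :=
  (∀ u ∈ G.activeSet P, ∀ v ∈ G.activeSet P, ¬ G.Adj u v) ∨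
  (∃ x ∈ P, ∃ y, y ∉ P ∧ G.Adj x y ∧ (∀ z, z ∉ P → G.Adj x z → z = y) ∧
    G.CoveredByPair (G.activeSet P) x x) ∨
  (∃ x ∈ G.activeSet P, (∀ z, z ∉ P → G.Adj x z → ∀ t ∈ P, G.Adj z t → t = x) ∧
    G.CoveredByPair (G.activeSet P) x x)

/-- Adding `w` to `P` gives a frame that is a star or a double star. -/
def FrameCovered (G : SimpleGraph V) (P : Finset V) (w : V) : Prop :=
  ∃ a b, (a = b ∨ G.Adj a b) ∧ G.CoveredByPair (insert w (G.activeSet P)) a b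

theorem extendable_empty : G.Extendable ∅ :=
  Or.inl fun u hu => by simp [activeSet] at hu

theorem activeSet_insert_subset [DecidableEq V] (P : Finset V) (w : V) :
    G.activeSet (insert w P) ⊆ insert w (G.activeSet P) := by
  rintro v ⟨hv, u, hu, hvu⟩
  rcases Finset.mem_insert.1 hv with rfl | hv
  · exact Set.mem_insert _ _
  · exact Or.inr ⟨hv, u, fun h => hu (Finset.mem_insert_of_mem h), hvu⟩

theorem eq_of_four_neighbors [Fintype V] [DecidableEq V] [DecidableRel G.Adj]
    (hdeg : ∀ v : V, G.degree v ≤ 3) {v p q s t : V} (hp : G.Adj v p) (hq : G.Adj v q)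
    (hs : G.Adj v s) (ht : G.Adj v t) (hpq : p ≠ q) (hps : p ≠ s) (hpt : p ≠ t) (hqs : q ≠ s)
    (hqt : q ≠ t) : s = t := by
  by_contra hst
  have hsub : ({p, q, s, t} : Finset V) ⊆ G.neighborFinset v := by
    intro z hz
    simp only [Finset.mem_insert, Finset.mem_singleton] at hz
    rw [mem_neighborFinset]
    rcases hz with rfl | rfl | rfl | rfl <;> assumption
  have h4 : ({p, q, s, t} : Finset V).card = 4 := by
    simp [Finset.card_insert_of_notMem, *]
  have := Finset.card_le_card hsub
  rw [card_neighborFinset_eq_degree] at this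
  have := hdeg v
  omega

/-- A vertex of a subcubic graph has no neighbour outside `P`, exactly one such neighbour, or
at most one neighbour in `P`. -/
theorem outside_neighbor_cases [Fintype V] [DecidableEq V] [DecidableRel G.Adj]
    (hdeg : ∀ v : V, G.degree v ≤ 3) (P : Finset V) (w : V) :
    (∀ z, z ∉ P → ¬ G.Adj w z) ∨
    (∃ y, y ∉ P ∧ G.Adj w y ∧ ∀ z, z ∉ P → G.Adj w z → z = y) ∨
    (∀ s ∈ P, ∀ t ∈ P, G.Adj w s → G.Adj w t → s = t) := by
  by_cases h0 : ∀ z, z ∉ P → ¬ G.Adj w z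
  · exact Or.inl h0
  push Not at h0
  obtain ⟨p, hp, hwp⟩ := h0
  by_cases h1 : ∀ z, z ∉ P → G.Adj w z → z = p
  · exact Or.inr (Or.inl ⟨p, hp, hwp, h1⟩)
  push Not at h1
  obtain ⟨q, hq, hwq, hqp⟩ := h1
  refine Or.inr (Or.inr fun s hs t ht hws hwt => ?_)
  exact eq_of_four_neighbors hdeg hwp hwq hws hwt hqp.symm (by grind) (by grind) (by grind)
    (by grind)

/-- If `x` is the only neighbour in `P` of each of its neighbours outside `P`, place one of
these. -/
theorem exists_step_of_private_neighbors [DecidableEq V] (htf : G.CliqueFree 3) {P : Finset V}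
    {x : V} (hx : x ∈ G.activeSet P)
    (hpriv : ∀ z, z ∉ P → G.Adj x z → ∀ t ∈ P, G.Adj z t → t = x)
    (hcov : G.CoveredByPair (G.activeSet P) x x) :
    ∃ w, w ∉ P ∧ G.FrameCovered P w ∧ G.Extendable (insert w P) := by
  obtain ⟨hxP, z, hz, hxz⟩ := hx
  have hframe : G.CoveredByPair (insert z (G.activeSet P)) x x := by
    rintro u (rfl | hu) v (rfl | hv) huv
    · exact (G.loopless.irrefl _ huv).elim
    · exact .inr (.inr (.inl (hpriv u hz hxz v hv.1 huv)))
    · exact .inl (hpriv v hz hxz u hu.1 huv.symm)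
    · exact hcov u hu v hv huv
  have hcov' : G.CoveredByPair (G.activeSet (insert z P)) x x := fun u hu v hv =>
    hframe u (activeSet_insert_subset P z hu) v (activeSet_insert_subset P z hv)
  refine ⟨z, hz, ⟨x, x, .inl rfl, hframe⟩, ?_⟩
  by_cases hx' : x ∈ G.activeSet (insert z P)
  · refine .inr (.inr ⟨x, hx', fun y hy hxy t ht hyt => ?_, hcov'⟩)
    rcases Finset.mem_insert.1 ht with rfl | ht
    · exact (htf.not_adj_of_adj_of_adj hxy hxz hyt).elim
    · exact hpriv y (fun h => hy (Finset.mem_insert_of_mem h)) hxy t ht hyt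
  · refine .inl fun u hu v hv huv => ?_
    have := hcov' u hu v hv huv
    grind

/-- If `y` is the only neighbour of `x` outside `P`, place `y`. -/
theorem exists_step_of_unique_neighbor [Fintype V] [DecidableEq V] [DecidableRel G.Adj]
    (hdeg : ∀ v : V, G.degree v ≤ 3) {P : Finset V} {x y : V} (hx : x ∈ P) (hy : y ∉ P)
    (hxy : G.Adj x y) (huniq : ∀ z, z ∉ P → G.Adj x z → z = y)
    (hcov : G.CoveredByPair (G.activeSet P) x x) :
    ∃ w, w ∉ P ∧ G.FrameCovered P w ∧ G.Extendable (insert w P) := by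
  have hframe : G.CoveredByPair (insert y (G.activeSet P)) x y := by
    rintro u (rfl | hu) v (rfl | hv) huv
    · simp
    · simp
    · simp
    · have := hcov u hu v hv huv
      tauto
  have hx' : x ∉ G.activeSet (insert y P) := by
    rintro ⟨-, u, hu, hxu⟩
    simp only [Finset.mem_insert, not_or] at hu
    exact hu.1 (huniq u hu.2 hxu)
  have hcov' : G.CoveredByPair (G.activeSet (insert y P)) y y := by
    intro u hu v hv huv
    have := hframe u (activeSet_insert_subset P y hu) v (activeSet_insert_subset P y hv) huv
    grind
  refine ⟨y, hy, ⟨x, y, .inr hxy, hframe⟩, ?_⟩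
  rcases outside_neighbor_cases hdeg P y with h0 | ⟨y', hy', hyy', huniq'⟩ | h2
  · refine .inl fun u hu v hv huv => ?_
    have hy' : y ∉ G.activeSet (insert y P) := by
      rintro ⟨-, u, hu, hyu⟩
      exact h0 u (fun h => hu (Finset.mem_insert_of_mem h)) hyu
    have := hcov' u hu v hv huv
    grind
  · refine .inr (.inl ⟨y, by simp, y', ?_, hyy', fun z hz => huniq' z ?_, hcov'⟩)
    · simp [hy', hyy'.ne']
    · exact fun h => hz (Finset.mem_insert_of_mem h)
  · refine .inl fun u hu v hv huv => ?_
    have key : ∀ t ∈ G.activeSet (insert y P), ¬ G.Adj y t := by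
      intro t ht hyt
      have htP : t ∈ P := by
        rcases Finset.mem_insert.1 ht.1 with rfl | h
        · exact (hyt.ne rfl).elim
        · exact h
      exact hx' (h2 t htP x hx hyt hxy.symm ▸ ht)
    have := hcov' u hu v hv huv
    have := huv.symm
    grind

/-- If the active vertices are independent, some vertex can be placed. -/
theorem exists_step_of_independent [Fintype V] [DecidableEq V] [DecidableRel G.Adj]
    (htf : G.CliqueFree 3) (hdeg : ∀ v : V, G.degree v ≤ 3) {P : Finset V}
    (hP : P ≠ Finset.univ)
    (hind : ∀ u ∈ G.activeSet P, ∀ v ∈ G.activeSet P, ¬ G.Adj u v) :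
    ∃ w, w ∉ P ∧ G.FrameCovered P w ∧ G.Extendable (insert w P) := by
  have hframe : ∀ w, G.CoveredByPair (insert w (G.activeSet P)) w w := by
    rintro w u (rfl | hu) v (rfl | hv) huv
    · simp
    · simp
    · simp
    · exact (hind u hu v hv huv).elim
  have hcov : ∀ w, G.CoveredByPair (G.activeSet (insert w P)) w w := fun w u hu v hv =>
    hframe w u (activeSet_insert_subset P w hu) v (activeSet_insert_subset P w hv)
  have hdone : ∀ w, w ∉ G.activeSet (insert w P) → G.Extendable (insert w P) := by
    refine fun w hw => .inl fun u hu v hv huv => ?_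
    have := hcov w u hu v hv huv
    grind
  by_cases h2 : ∀ w, w ∉ P → ∀ s ∈ P, ∀ t ∈ P, G.Adj w s → G.Adj w t → s = t
  · rcases (G.activeSet P).eq_empty_or_nonempty with hempty | ⟨x, hx⟩
    · obtain ⟨w, hw⟩ : ∃ w, w ∉ P := by
        simpa [Finset.eq_univ_iff_forall] using hP
      refine ⟨w, hw, ⟨w, w, .inl rfl, hframe w⟩, .inl fun u hu v hv huv => ?_⟩
      have hu := activeSet_insert_subset P w hu
      have hv := activeSet_insert_subset P w hv
      simp only [hempty, Set.mem_insert_iff, Set.mem_empty_iff_false, or_false] at hu hv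
      exact huv.ne (hu.trans hv.symm)
    · exact exists_step_of_private_neighbors htf hx
        (fun z hz hxz t ht hzt => h2 z hz t ht x hx.1 hzt hxz.symm)
        (fun u hu v hv huv => (hind u hu v hv huv).elim)
  · push Not at h2
    obtain ⟨w, hw, s, hs, t, ht, hws, hwt, hst⟩ := h2
    refine ⟨w, hw, ⟨w, w, .inl rfl, hframe w⟩, ?_⟩
    rcases outside_neighbor_cases hdeg P w with h0 | ⟨y, hy, hwy, huniq⟩ | h2
    · refine hdone w ?_
      rintro ⟨-, u, hu, hwu⟩
      exact h0 u (fun h => hu (Finset.mem_insert_of_mem h)) hwu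
    · refine .inr (.inl ⟨w, by simp, y, ?_, hwy, fun z hz => huniq z ?_, hcov w⟩)
      · simp [hy, hwy.ne']
      · exact fun h => hz (Finset.mem_insert_of_mem h)
    · exact (hst (h2 s hs t ht hws hwt)).elim

theorem Extendable.exists_step [Fintype V] [DecidableEq V] [DecidableRel G.Adj]
    (htf : G.CliqueFree 3) (hdeg : ∀ v : V, G.degree v ≤ 3) {P : Finset V}
    (hP : P ≠ Finset.univ) (hext : G.Extendable P) :
    ∃ w, w ∉ P ∧ G.FrameCovered P w ∧ G.Extendable (insert w P) := by
  rcases hext with hind | ⟨x, hx, y, hy, hxy, huniq, hcov⟩ | ⟨x, hx, hpriv, hcov⟩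
  · exact exists_step_of_independent htf hdeg hP hind
  · exact exists_step_of_unique_neighbor hdeg hx hy hxy huniq hcov
  · exact exists_step_of_private_neighbors htf hx hpriv hcov

end SimpleGraph

/-- An invariant of finite sets that can always be kept by adding a new element yields a
numbering of the whole type whose initial segments are the sets so obtained. -/
theorem exists_equiv_fin_of_step {V : Type*} [Fintype V] [DecidableEq V]
    (I : Finset V → Prop) (R : Finset V → V → Prop) (h0 : I ∅)
    (hstep : ∀ P, P ≠ Finset.univ → I P → ∃ w, w ∉ P ∧ R P w ∧ I (insert w P)) :
    ∃ τ : V ≃ Fin (Fintype.card V), ∀ i, R {v | τ v < i} (τ.symm i) := by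
  have key : ∀ k ≤ Fintype.card V, ∃ l : List V, l.Nodup ∧ l.length = k ∧ I l.toFinset ∧
      ∀ i (hi : i < l.length), R (l.take i).toFinset l[i] := by
    intro k
    induction k with
    | zero => exact fun _ => ⟨[], by simpa using h0⟩
    | succ k ih =>
      intro hk
      obtain ⟨l, hnd, hlen, hI, hR⟩ := ih (by omega)
      have hne : l.toFinset ≠ Finset.univ := by
        intro h
        have := congrArg Finset.card h
        rw [List.toFinset_card_of_nodup hnd, Finset.card_univ] at this
        omega
      obtain ⟨w, hw, hRw, hIw⟩ := hstep _ hne hI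
      rw [List.mem_toFinset] at hw
      refine ⟨l ++ [w], ?_, by simp [hlen], ?_, ?_⟩
      · simpa [List.nodup_append, hnd] using fun a ha (h : a = w) => hw (h ▸ ha)
      · have : (l ++ [w]).toFinset = insert w l.toFinset := by
          ext
          simp
        rwa [this]
      · intro i hi
        rcases Nat.lt_or_ge i l.length with hil | hil
        · rw [List.getElem_append_left hil, List.take_append_of_le_length hil.le]
          exact hR i hil
        · obtain rfl : i = l.length := by
            simp at hi
            omega
          simpa using hRw
  obtain ⟨l, hnd, hlen, -, hR⟩ := key _ le_rfl
  have hinj : Function.Injective fun i : Fin (Fintype.card V) => l[i.val]'(hlen.symm ▸ i.2) :=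
    fun i j hij => Fin.ext ((hnd.getElem_inj_iff).1 hij)
  have hbij := (Fintype.bijective_iff_injective_and_card _).2 ⟨hinj, Fintype.card_fin _⟩
  refine ⟨(Equiv.ofBijective _ hbij).symm, fun i => ?_⟩
  have hi : i.val < l.length := hlen.symm ▸ i.2
  rw [Equiv.symm_symm, Equiv.ofBijective_apply]
  convert hR i hi using 1
  ext v
  obtain ⟨j, rfl⟩ := (Equiv.ofBijective _ hbij).surjective v
  have hj : j.val < l.length := hlen.symm ▸ j.2
  rw [Finset.mem_filter_univ, Equiv.symm_apply_apply, Equiv.ofBijective_apply,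
    List.mem_toFinset, List.mem_take_iff_getElem]
  constructor
  · exact fun h => ⟨j, by simpa using ⟨h, hj⟩, rfl⟩
  · rintro ⟨m, hm, hmj⟩
    have := hnd.getElem_inj_iff.1 hmj
    omega

/-- The vertices visible at step `i` are the one placed at step `i` and the earlier ones that
have a neighbour not placed before step `i`. -/
theorem setOf_visibleAt {V : Type*} [Fintype V] [DecidableEq V] {n : ℕ} (G : SimpleGraph V)
    (τ : V ≃ Fin n) (i : Fin n) :
    {v | visibleAt G τ v i} = insert (τ.symm i) (G.activeSet {v | τ v < i}) := by
  ext v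
  simp only [visibleAt, SimpleGraph.activeSet, Set.mem_insert_iff, Set.mem_ofPred_eq,
    Finset.mem_filter, Finset.mem_univ, true_and, not_lt, Equiv.eq_symm_apply]
  constructor
  · rintro ⟨hle, u, rfl | hadj, hu⟩
    · exact .inl (le_antisymm hle hu)
    · rcases hle.eq_or_lt with h | h
      · exact .inl h
      · exact .inr ⟨h, u, hu, hadj⟩
  · rintro (h | ⟨h, u, hu, hadj⟩)
    · exact ⟨h.le, v, .inl rfl, h.ge⟩
    · exact ⟨h.le, u, .inr hadj, hu⟩

/-- Every triangle-free subcubic graph admits a forest storyplan in which every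
frame has at most five edges. -/
theorem stmt_12 {V : Type*} [Fintype V] [DecidableEq V] (G : SimpleGraph V)
    [DecidableRel G.Adj]
    (htf : G.CliqueFree 3) (hdeg : ∀ v : V, G.degree v ≤ 3) :
    ∃ τ : V ≃ Fin (Fintype.card V),
      ∀ i, (frame G τ i).IsAcyclic ∧ (frame G τ i).edgeSet.ncard ≤ 5 := by
  obtain ⟨τ, hτ⟩ := exists_equiv_fin_of_step G.Extendable G.FrameCovered
    SimpleGraph.extendable_empty fun _ hP hext => hext.exists_step htf hdeg hP
  refine ⟨τ, fun i => ?_⟩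
  obtain ⟨a, b, hab, hcov⟩ := hτ i
  rw [← setOf_visibleAt] at hcov
  exact ⟨hcov.isAcyclic_induce htf hab, hcov.ncard_edgeSet_induce_le hdeg hab⟩
end

section
/- Let G be a triangle-free outerplanar graph with an outerplanar embedding, and let τ order the vertices according to their cyclic order along the outer face (starting at an arbitrary vertex). Then for every inner face F of the embedding, there is no step at which all vertices of F are simultaneously visible; consequently τ is a forest storyplan order. -/
/-- `τ` is the vertex order along the outer face of an outerplane embedding of
`G`: all vertices lie on a circle in this order and edges are pairwise
noncrossing chords. -/
def Noncrossing {V : Type*} {n : ℕ} (G : SimpleGraph V) (τ : V ≃ Fin n) : Prop :=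
  ∀ a b c d : V, τ a < τ b → τ b < τ c → τ c < τ d →
    G.Adj a c → G.Adj b d → False

/-- `S` is (the vertex set of) an inner face of the outerplane embedding of `G`
given by the noncrossing order `τ`: `S` is the vertex set of a cycle and the
only edges of `G` between vertices of `S` join cyclically consecutive ones. -/
def IsInnerFace {V : Type*} {n : ℕ} (G : SimpleGraph V) (τ : V ≃ Fin n)
    (S : Set V) : Prop :=
  (∃ (v : V) (w : G.Walk v v), w.IsCycle ∧ S = {x | x ∈ w.support}) ∧
  ∀ u w, u ∈ S → w ∈ S → G.Adj u w →
    (∀ x ∈ S, ¬ (τ u < τ x ∧ τ x < τ w)) ∨ (∀ x ∈ S, ¬ (τ w < τ x ∧ τ x < τ u))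
/-- In a noncrossing triangle-free graph no cycle is ever entirely visible: its first vertex `m`
would have two later neighbors `x`, `y` on the cycle with `x` before `y`, and since `x` is still
visible when `y` has appeared, noncrossing makes `x` adjacent to `y`. -/
theorem Noncrossing.not_forall_support_visibleAt {V : Type*} {n : ℕ} {G : SimpleGraph V}
    {τ : V ≃ Fin n} (hτ : Noncrossing G τ) (htf : G.CliqueFree 3) (i : Fin n) {v : V}
    {c : G.Walk v v} (hc : c.IsCycle) : ¬ ∀ x ∈ c.support, visibleAt G τ x i := by
  classical
  intro hvis
  obtain ⟨m, hm, hmin⟩ := c.support.toFinset.exists_min_image τ ⟨v, by simp⟩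
  rw [List.mem_toFinset] at hm
  have no_fan : ∀ x y, x ∈ c.support → y ∈ c.support → G.Adj m x → G.Adj m y →
      τ x < τ y → False := by
    intro x y hx hy hmx hmy hxy
    have hmx' : τ m < τ x := lt_of_le_of_ne (hmin x (List.mem_toFinset.2 hx))
      fun h => hmx.ne (τ.injective h)
    obtain ⟨-, u, hu, hiu⟩ := hvis x hx
    have hyu : τ y ≤ τ u := (hvis y hy).1.trans hiu
    rcases hu with rfl | hxu
    · exact absurd hxy hyu.not_gt
    · rcases hyu.lt_or_eq with h | h
      · exact hτ m x y u hmx' hxy h hmy hxu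
      · obtain rfl := τ.injective h
        exact htf {m, x, y} (SimpleGraph.is3Clique_triple_iff.2 ⟨hmx, hmy, hxu⟩)
  have hc' := hc.rotate hm
  have hsupp : ∀ x ∈ (c.rotate m hm).support, x ∈ c.support := fun x hx =>
    (c.mem_support_rotate_iff m hm).1 hx
  have hsnd := (c.rotate m hm).adj_snd hc'.not_nil
  have hpen := ((c.rotate m hm).adj_penultimate hc'.not_nil).symm
  have hsnd' : (c.rotate m hm).snd ∈ c.support :=
    hsupp _ ((c.rotate m hm).getVert_mem_support _)
  have hpen' : (c.rotate m hm).penultimate ∈ c.support :=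
    hsupp _ ((c.rotate m hm).getVert_mem_support _)
  rcases lt_or_gt_of_ne (τ.injective.ne hc'.snd_ne_penultimate) with h | h
  · exact no_fan _ _ hsnd' hpen' hsnd hpen h
  · exact no_fan _ _ hpen' hsnd' hpen hsnd h

/-- Let `G` be triangle-free and outerplane with outer-face vertex order `τ`.
Then no inner face ever has all of its vertices simultaneously visible, and
consequently `τ` is a forest storyplan order. -/
theorem stmt_13 {V : Type*} [Fintype V] (G : SimpleGraph V)
    (htf : G.CliqueFree 3)
    (τ : V ≃ Fin (Fintype.card V)) (hτ : Noncrossing G τ) :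
    (∀ S : Set V, IsInnerFace G τ S →
      ∀ i, ¬ ∀ v ∈ S, visibleAt G τ v i) ∧
    IsForestStoryplan G τ := by
  refine ⟨?_, fun i v c hc => ?_⟩
  · rintro S ⟨⟨v, c, hc, rfl⟩, -⟩ i
    exact hτ.not_forall_support_visibleAt htf i hc
  · let f := SimpleGraph.Embedding.induce (G := G) {v | visibleAt G τ v i}
    refine hτ.not_forall_support_visibleAt htf i (hc.map (f := f.toHom) f.injective) ?_
    intro x hx
    obtain ⟨y, -, rfl⟩ := List.mem_map.1 (SimpleGraph.Walk.support_map f.toHom c ▸ hx)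
    exact y.2
end
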